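/- Let φ : ℝ² → ℝ be a C² function and λ > 0 with Δφ = −λφ on the unit square D = [0,1]² and φ = 0 on ∂D. Fix c ∈ (0,1) and suppose the function y ↦ φ(c,y) is not identically zero on (0,1). Then the number of zeros of y ↦ φ(c,y) in the open interval (0,1) is at most √λ/π. -/

import Mathlib

open Real

/-- The Euclidean Laplacian of a function `φ : ℝ × ℝ → ℝ`. -/
noncomputable def laplacian2 (φ : ℝ × ℝ → ℝ) (p : ℝ × ℝ) : ℝ :=
  deriv (fun x => deriv (fun x' => φ (x', p.2)) x) p.1 +
  deriv (fun y => deriv (fun y' => φ (p.1, y')) y) p.2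

theorem integral_cos_int_mul_pi {n : ℤ} (hn : n ≠ 0) :
    ∫ y in (0 : ℝ)..1, cos (n * (π * y)) = 0 := by
  have hn' : (n : ℝ) * π ≠ 0 := mul_ne_zero (Int.cast_ne_zero.2 hn) pi_ne_zero
  simp_rw [← mul_assoc]
  rw [intervalIntegral.integral_comp_mul_left (fun y => cos y) hn']
  simp [sin_int_mul_pi]

theorem integral_sin_nat_mul_sin_nat {a b : ℕ} (ha : 0 < a) :
    ∫ y in (0 : ℝ)..1, sin (a * (π * y)) * sin (b * (π * y)) = if a = b then 1 / 2 else 0 := by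
  have key : ∀ y : ℝ, sin (a * (π * y)) * sin (b * (π * y)) =
      (cos (((a - b : ℤ) : ℝ) * (π * y)) - cos (((a + b : ℤ) : ℝ) * (π * y))) / 2 := by
    intro y
    push_cast
    rw [sub_mul, add_mul, cos_sub, cos_add]
    ring
  simp_rw [key]
  rw [intervalIntegral.integral_div, intervalIntegral.integral_sub
    (Continuous.intervalIntegrable (by fun_prop) _ _)
    (Continuous.intervalIntegrable (by fun_prop) _ _),
    integral_cos_int_mul_pi (show (a + b : ℤ) ≠ 0 by omega)]
  split_ifs with h
  · simp [h]
  · rw [integral_cos_int_mul_pi (show (a - b : ℤ) ≠ 0 by omega)]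
    simp

theorem integral_mul_cos_pow_mul_sin_eq_zero {h : ℝ → ℝ} (hc : Continuous h)
    (horth : ∀ n : ℕ, ∫ y in (0 : ℝ)..1, h y * sin (n * (π * y)) = 0) (m n : ℕ) :
    ∫ y in (0 : ℝ)..1, h y * (cos (π * y) ^ m * sin (n * (π * y))) = 0 := by
  induction m generalizing n with
  | zero => simpa using horth n
  | succ m ih =>
    rcases n with _ | n
    · simp
    have key : ∀ y : ℝ, h y * (cos (π * y) ^ (m + 1) * sin ((n + 1 : ℕ) * (π * y))) =
        (h y * (cos (π * y) ^ m * sin ((n + 2 : ℕ) * (π * y))) +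
          h y * (cos (π * y) ^ m * sin (n * (π * y)))) / 2 := by
      intro y
      have h1 : ((n + 2 : ℕ) : ℝ) * (π * y) = (n + 1 : ℕ) * (π * y) + π * y := by push_cast; ring
      have h2 : (n : ℝ) * (π * y) = (n + 1 : ℕ) * (π * y) - π * y := by push_cast; ring
      rw [h1, h2, sin_add, sin_sub]
      ring
    simp_rw [key]
    rw [intervalIntegral.integral_div, intervalIntegral.integral_add
      (Continuous.intervalIntegrable (by fun_prop) _ _)
      (Continuous.intervalIntegrable (by fun_prop) _ _), ih, ih]
    simp

theorem integral_mul_eval_cos_mul_sin_eq_zero {h : ℝ → ℝ} (hc : Continuous h)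
    (horth : ∀ n : ℕ, ∫ y in (0 : ℝ)..1, h y * sin (n * (π * y)) = 0) (P : Polynomial ℝ) :
    ∫ y in (0 : ℝ)..1, h y * (P.eval (cos (π * y)) * sin (π * y)) = 0 := by
  induction P using Polynomial.induction_on' with
  | add p q hp hq =>
    simp_rw [Polynomial.eval_add, add_mul, mul_add]
    rw [intervalIntegral.integral_add
      (Continuous.intervalIntegrable (by fun_prop) _ _)
      (Continuous.intervalIntegrable (by fun_prop) _ _), hp, hq, add_zero]
  | monomial m a =>
    have := integral_mul_cos_pow_mul_sin_eq_zero hc horth m 1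
    simp_rw [Polynomial.eval_monomial, mul_assoc, mul_left_comm _ a]
    rw [intervalIntegral.integral_const_mul]
    simp_all

/-- The functions `y ↦ sin (nπy)` are complete in the continuous functions on `(0, 1)`. -/
theorem eq_zero_of_integral_mul_sin_eq_zero {h : ℝ → ℝ} (hc : Continuous h)
    (horth : ∀ n : ℕ, ∫ y in (0 : ℝ)..1, h y * sin (n * (π * y)) = 0)
    {y : ℝ} (hy : y ∈ Set.Ioo (0 : ℝ) 1) : h y = 0 := by
  have hsin : ∀ t ∈ Set.Icc (0 : ℝ) 1, 0 ≤ sin (π * t) := fun t ht =>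
    sin_nonneg_of_nonneg_of_le_pi (mul_nonneg pi_pos.le ht.1)
      (mul_le_of_le_one_right pi_pos.le ht.2)
  have hle : ∫ t in (0 : ℝ)..1, h t ^ 2 * sin (π * t) ≤ 0 := by
    set C := ∫ t in (0 : ℝ)..1, |h t|
    have hC0 : 0 ≤ C := intervalIntegral.integral_nonneg zero_le_one fun t _ => abs_nonneg _
    have bound : ∀ ε > 0, ∫ t in (0 : ℝ)..1, h t ^ 2 * sin (π * t) ≤ ε * C := by
      intro ε hε
      obtain ⟨P, hP⟩ := exists_polynomial_near_of_continuousOn (-1) 1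
        (fun u => h (arccos u / π))
        (hc.comp (continuous_arccos.div_const π)).continuousOn ε hε
      calc ∫ t in (0 : ℝ)..1, h t ^ 2 * sin (π * t)
          = ∫ t in (0 : ℝ)..1, (h t ^ 2 * sin (π * t) -
              h t * (P.eval (cos (π * t)) * sin (π * t))) := by
            rw [intervalIntegral.integral_sub
              (Continuous.intervalIntegrable (by fun_prop) _ _)
              (Continuous.intervalIntegrable (by fun_prop) _ _),
              integral_mul_eval_cos_mul_sin_eq_zero hc horth, sub_zero]
        _ ≤ ∫ t in (0 : ℝ)..1, ε * |h t| := by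
            refine intervalIntegral.integral_mono_on zero_le_one
              (Continuous.intervalIntegrable (by fun_prop) _ _)
              (Continuous.intervalIntegrable (by fun_prop) _ _) fun t ht => ?_
            have hclose := hP (cos (π * t)) ⟨neg_one_le_cos _, cos_le_one _⟩
            rw [arccos_cos (mul_nonneg pi_pos.le ht.1)
              (mul_le_of_le_one_right pi_pos.le ht.2), mul_div_cancel_left₀ _ pi_ne_zero] at hclose
            calc h t ^ 2 * sin (π * t) - h t * (P.eval (cos (π * t)) * sin (π * t))
                = h t * (h t - P.eval (cos (π * t))) * sin (π * t) := by ring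
              _ ≤ |h t * (h t - P.eval (cos (π * t))) * sin (π * t)| := le_abs_self _
              _ = |P.eval (cos (π * t)) - h t| * |h t| * |sin (π * t)| := by
                  rw [abs_mul, abs_mul, abs_sub_comm, mul_comm |h t|]
              _ ≤ ε * |h t| * 1 := by
                  gcongr
                  exact abs_sin_le_one _
              _ = ε * |h t| := mul_one _
        _ = ε * C := by rw [intervalIntegral.integral_const_mul]
    refine le_of_forall_pos_le_add fun δ hδ => ?_
    refine (bound (δ / (C + 1)) (by positivity)).trans ?_
    rw [zero_add, div_mul_eq_mul_div, div_le_iff₀ (by positivity)]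
    nlinarith
  by_contra hne
  have hpos : 0 < sin (π * y) := sin_pos_of_pos_of_lt_pi (mul_pos pi_pos hy.1)
    (mul_lt_of_lt_one_right pi_pos hy.2)
  refine hle.not_gt (intervalIntegral.integral_pos one_pos (by fun_prop) (fun t ht => ?_)
    ⟨y, Set.Ioo_subset_Icc_self hy, by positivity⟩)
  exact mul_nonneg (sq_nonneg _) (hsin t (Set.Ioc_subset_Icc_self ht))

theorem hasDerivAt_integral_mul_of_contDiff {F : ℝ × ℝ → ℝ} (hF : ContDiff ℝ 1 F)
    {s : ℝ → ℝ} (hs : Continuous s) (a b x : ℝ) :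
    HasDerivAt (fun x => ∫ y in a..b, F (x, y) * s y)
      (∫ y in a..b, fderiv ℝ F (x, y) (1, 0) * s y) x := by
  have hFc := hF.continuous
  have hF' : Continuous fun p : ℝ × ℝ => fderiv ℝ F p (1, 0) * s p.2 :=
    ((hF.continuous_fderiv one_ne_zero).clm_apply continuous_const).mul (hs.comp continuous_snd)
  obtain ⟨C, hC⟩ := ((isCompact_closedBall x 1).prod isCompact_uIcc).exists_bound_of_continuousOn
    (f := fun p : ℝ × ℝ => fderiv ℝ F p (1, 0) * s p.2) (s := Metric.closedBall x 1 ×ˢ Set.uIcc a b)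
    hF'.continuousOn
  refine (intervalIntegral.hasDerivAt_integral_of_dominated_loc_of_deriv_le
    (F' := fun x y => fderiv ℝ F (x, y) (1, 0) * s y) (bound := fun _ => C)
    (Metric.closedBall_mem_nhds x one_pos) (.of_forall fun x' => ?_)
    (Continuous.intervalIntegrable (by fun_prop) _ _) ?_ (.of_forall fun y hy x' hx' => ?_)
    intervalIntegrable_const (.of_forall fun y _ x' _ => ?_)).2
  · exact Continuous.aestronglyMeasurable (by fun_prop)
  · exact Continuous.aestronglyMeasurable (hF'.comp (by fun_prop : Continuous fun y => (x, y)))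
  · exact hC (x', y) ⟨hx', Set.uIoc_subset_uIcc hy⟩
  · refine HasDerivAt.mul_const ?_ _
    exact ((hF.differentiable one_ne_zero (x', y)).hasFDerivAt.comp_hasDerivAt x'
      ((hasDerivAt_id x').prodMk (hasDerivAt_const x' y)))

/-- A solution of `f'' = μ f` on `[0, 1]` with `0 ≤ μ` and vanishing boundary values is zero. -/
theorem eq_zero_of_hasDerivAt_of_boundary {f f' f'' : ℝ → ℝ} {μ : ℝ} (hμ : 0 ≤ μ)
    (hf : ∀ x, HasDerivAt f (f' x) x) (hf' : ∀ x, HasDerivAt f' (f'' x) x)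
    (heq : ∀ x ∈ Set.Icc (0 : ℝ) 1, f'' x = μ * f x) (h0 : f 0 = 0) (h1 : f 1 = 0)
    {x : ℝ} (hx : x ∈ Set.Icc (0 : ℝ) 1) : f x = 0 := by
  have hconv : ConvexOn ℝ (Set.Icc (0 : ℝ) 1) fun x => f x * f x := by
    refine convexOn_of_hasDerivWithinAt2_nonneg (convex_Icc 0 1)
      (f' := fun x => f' x * f x + f x * f' x)
      (f'' := fun x => f'' x * f x + f' x * f' x + (f' x * f' x + f x * f'' x))
      (fun x _ => ((hf x).mul (hf x)).continuousAt.continuousWithinAt)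
      (fun x _ => ((hf x).mul (hf x)).hasDerivWithinAt)
      (fun x _ => (((hf' x).mul (hf x)).add ((hf x).mul (hf' x))).hasDerivWithinAt) fun x hx => ?_
    rw [heq x (interior_subset hx)]
    nlinarith [mul_nonneg hμ (mul_self_nonneg (f x)), mul_self_nonneg (f' x)]
  have := hconv.le_max_of_mem_Icc (Set.left_mem_Icc.2 zero_le_one)
    (Set.right_mem_Icc.2 zero_le_one) hx
  simp only [h0, h1, mul_zero, max_self] at this
  exact mul_self_eq_zero.1 (this.antisymm (mul_self_nonneg _))

/-- If `g` vanishes at `0` and `1`, its second derivative has `sin (nπ·)`-coefficient `-n²π²` times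
that of `g`. -/
theorem integral_deriv2_mul_sin {g g' g'' : ℝ → ℝ} (hg : ∀ y, HasDerivAt g (g' y) y)
    (hg' : ∀ y, HasDerivAt g' (g'' y) y) (hg'' : Continuous g'') (h0 : g 0 = 0) (h1 : g 1 = 0)
    (n : ℕ) :
    ∫ y in (0 : ℝ)..1, g'' y * sin (n * (π * y)) =
      -(n * π) ^ 2 * ∫ y in (0 : ℝ)..1, g y * sin (n * (π * y)) := by
  have hlin : ∀ y : ℝ, HasDerivAt (fun y : ℝ => n * (π * y)) (n * π) y := fun y => by
    simpa using ((hasDerivAt_id y).const_mul π).const_mul (n : ℝ)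
  have hS : ∀ y : ℝ, HasDerivAt (fun y : ℝ => sin (n * (π * y)))
      (cos (n * (π * y)) * (n * π)) y := fun y => (hlin y).sin
  have hK : ∀ y : ℝ, HasDerivAt (fun y : ℝ => cos (n * (π * y)) * (n * π))
      (-sin (n * (π * y)) * (n * π) * (n * π)) y := fun y => (hlin y).cos.mul_const _
  have hg'c : Continuous g' := continuous_iff_continuousAt.2 fun y => (hg' y).continuousAt
  have e1 := intervalIntegral.integral_mul_deriv_eq_deriv_mul (a := 0) (b := 1)
    (fun y _ => hS y) (fun y _ => hg' y) (Continuous.intervalIntegrable (by fun_prop) _ _)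
    (hg''.intervalIntegrable _ _)
  have e2 := intervalIntegral.integral_mul_deriv_eq_deriv_mul (a := 0) (b := 1)
    (fun y _ => hK y) (fun y _ => hg y) (Continuous.intervalIntegrable (by fun_prop) _ _)
    (hg'c.intervalIntegrable _ _)
  simp only [mul_comm (g'' _)]
  rw [e1, e2, ← intervalIntegral.integral_const_mul]
  simp only [h0, h1, mul_one, mul_zero, sin_nat_mul_pi, sin_zero, zero_mul, sub_self, zero_sub,
    neg_neg]
  exact intervalIntegral.integral_congr fun y _ => by ring

/-- A sine polynomial with modes `1, …, N` that is not identically zero on `(0, 1)` has at most `N`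
zeros there. -/
theorem ncard_zeros_le_of_eq_sum_sin {g : ℝ → ℝ} {N : ℕ} (a : ℕ → ℝ)
    (hg : ∀ y ∈ Set.Ioo (0 : ℝ) 1, g y = ∑ k ∈ Finset.range N, a k * sin ((k + 1 : ℕ) * (π * y)))
    (hne : ∃ y ∈ Set.Ioo (0 : ℝ) 1, g y ≠ 0) :
    {y ∈ Set.Ioo (0 : ℝ) 1 | g y = 0}.Finite ∧
      {y ∈ Set.Ioo (0 : ℝ) 1 | g y = 0}.ncard ≤ N := by
  set P : Polynomial ℝ :=
    ∑ k ∈ Finset.range N, Polynomial.C (a k) * Polynomial.Chebyshev.U ℝ k with hP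
  have hgP : ∀ y ∈ Set.Ioo (0 : ℝ) 1, g y = P.eval (cos (π * y)) * sin (π * y) := by
    intro y hy
    rw [hg y hy, hP, Polynomial.eval_finsetSum, Finset.sum_mul]
    refine Finset.sum_congr rfl fun k _ => ?_
    rw [Polynomial.eval_mul, Polynomial.eval_C, mul_assoc, Polynomial.Chebyshev.U_real_cos]
    push_cast
    rfl
  have hP0 : P ≠ 0 := by
    intro h
    obtain ⟨y, hy, hgy⟩ := hne
    exact hgy (by rw [hgP y hy, h, Polynomial.eval_zero, zero_mul])
  have hdeg : P.natDegree ≤ N := by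
    refine Polynomial.natDegree_sum_le_of_forall_le _ _ fun k hk => ?_
    refine (Polynomial.natDegree_C_mul_le _ _).trans ?_
    rw [Polynomial.Chebyshev.natDegree_U_natCast]
    exact (Finset.mem_range.1 hk).le
  have hmaps : Set.MapsTo (fun y => cos (π * y)) {y ∈ Set.Ioo (0 : ℝ) 1 | g y = 0}
      (P.roots.toFinset : Set ℝ) := by
    rintro y ⟨hy, hgy⟩
    have hpos : 0 < sin (π * y) := sin_pos_of_pos_of_lt_pi (mul_pos pi_pos hy.1)
      (mul_lt_of_lt_one_right pi_pos hy.2)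
    rw [hgP y hy] at hgy
    simpa [hP0] using (mul_eq_zero.1 hgy).resolve_right hpos.ne'
  have hinj : Set.InjOn (fun y => cos (π * y)) {y ∈ Set.Ioo (0 : ℝ) 1 | g y = 0} := by
    have hmem : ∀ y ∈ Set.Ioo (0 : ℝ) 1, π * y ∈ Set.Icc 0 π := fun y hy =>
      ⟨mul_nonneg pi_pos.le hy.1.le, mul_le_of_le_one_right pi_pos.le hy.2.le⟩
    intro x hx y hy hxy
    exact mul_left_cancel₀ pi_ne_zero (injOn_cos (hmem x hx.1) (hmem y hy.1) hxy)
  refine ⟨Set.Finite.of_injOn hmaps hinj (Finset.finite_toSet _), ?_⟩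
  refine (Set.ncard_le_ncard_of_injOn _ hmaps hinj (Finset.finite_toSet _)).trans ?_
  rw [Set.ncard_coe_finset]
  exact (Multiset.toFinset_card_le _).trans ((Polynomial.card_roots' P).trans hdeg)

/-- A continuous function whose sine coefficients of order greater than `N` vanish equals its
`N`-th partial sine sum on `(0, 1)`. -/
theorem eq_sum_sin_of_integral_mul_sin_eq_zero {g : ℝ → ℝ} (hc : Continuous g) {N : ℕ}
    (hzero : ∀ n, N < n → ∫ y in (0 : ℝ)..1, g y * sin (n * (π * y)) = 0)
    {y : ℝ} (hy : y ∈ Set.Ioo (0 : ℝ) 1) :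
    g y = ∑ k ∈ Finset.range N, (2 * ∫ t in (0 : ℝ)..1, g t * sin ((k + 1 : ℕ) * (π * t))) *
      sin ((k + 1 : ℕ) * (π * y)) := by
  set a : ℕ → ℝ := fun k => 2 * ∫ t in (0 : ℝ)..1, g t * sin ((k + 1 : ℕ) * (π * t)) with ha
  refine sub_eq_zero.1 (eq_zero_of_integral_mul_sin_eq_zero
    (h := fun y => g y - ∑ k ∈ Finset.range N, a k * sin ((k + 1 : ℕ) * (π * y)))
    (by fun_prop) (fun n => ?_) hy)
  have hsum : ∫ t in (0 : ℝ)..1,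
      ∑ k ∈ Finset.range N, a k * (sin ((k + 1 : ℕ) * (π * t)) * sin (n * (π * t))) =
      ∑ k ∈ Finset.range N, a k * if k + 1 = n then 1 / 2 else 0 := by
    rw [intervalIntegral.integral_finsetSum
      fun k _ => Continuous.intervalIntegrable (by fun_prop) _ _]
    exact Finset.sum_congr rfl fun k _ => by
      rw [intervalIntegral.integral_const_mul, integral_sin_nat_mul_sin_nat k.succ_pos]
  simp_rw [sub_mul, Finset.sum_mul, mul_assoc]
  rw [intervalIntegral.integral_sub (Continuous.intervalIntegrable (by fun_prop) _ _)
    (Continuous.intervalIntegrable (by fun_prop) _ _), hsum]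
  rcases n with _ | n
  · simp
  · simp only [Nat.add_right_cancel_iff, mul_ite, mul_zero, Finset.sum_ite_eq', Finset.mem_range]
    split_ifs with hn
    · simp only [ha]
      ring
    · rw [hzero _ (by omega), sub_zero]

/-- The fibrewise sine coefficients of order `n ≥ √λ/π` of a Dirichlet eigenfunction with
eigenvalue `λ` on the unit square vanish. -/
theorem integral_eigenfunction_mul_sin_eq_zero {φ : ℝ × ℝ → ℝ} {lam : ℝ}
    (hC2 : ContDiff ℝ 2 φ)
    (heig : ∀ p ∈ Set.Icc (0 : ℝ) 1 ×ˢ Set.Icc (0 : ℝ) 1, laplacian2 φ p = -lam * φ p)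
    (hbd : ∀ p ∈ frontier (Set.Icc (0 : ℝ) 1 ×ˢ Set.Icc (0 : ℝ) 1), φ p = 0)
    {n : ℕ} (hn : lam ≤ (n * π) ^ 2) {c : ℝ} (hc : c ∈ Set.Icc (0 : ℝ) 1) :
    ∫ y in (0 : ℝ)..1, φ (c, y) * sin (n * (π * y)) = 0 := by
  have hfr : ∀ x ∈ Set.Icc (0 : ℝ) 1, ∀ y ∈ Set.Icc (0 : ℝ) 1,
      (x = 0 ∨ x = 1) ∨ (y = 0 ∨ y = 1) → φ (x, y) = 0 := by
    intro x hx y hy hxy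
    apply hbd
    rw [frontier_prod_eq, frontier_Icc zero_le_one, isClosed_Icc.closure_eq]
    rcases hxy with h | h
    · exact Or.inr ⟨h, hy⟩
    · exact Or.inl ⟨hx, h⟩
  have hdir : ∀ {F : ℝ × ℝ → ℝ} (_ : Differentiable ℝ F) (x y : ℝ),
      HasDerivAt (fun x' => F (x', y)) (fderiv ℝ F (x, y) (1, 0)) x ∧
      HasDerivAt (fun y' => F (x, y')) (fderiv ℝ F (x, y) (0, 1)) y := fun hF x y =>
    ⟨(hF (x, y)).hasFDerivAt.comp_hasDerivAt x ((hasDerivAt_id x).prodMk (hasDerivAt_const x y)),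
      (hF (x, y)).hasFDerivAt.comp_hasDerivAt y ((hasDerivAt_const y x).prodMk (hasDerivAt_id y))⟩
  have hpart : ∀ v : ℝ × ℝ, ContDiff ℝ 1 fun p => fderiv ℝ φ p v := fun v =>
    (hC2.fderiv_right (by norm_num)).clm_apply contDiff_const
  have hd0 : Differentiable ℝ φ := hC2.differentiable two_ne_zero
  have hd1 : ∀ v : ℝ × ℝ, Differentiable ℝ fun p => fderiv ℝ φ p v := fun v =>
    (hpart v).differentiable one_ne_zero
  have hcont : ∀ v w : ℝ × ℝ, Continuous fun p => fderiv ℝ (fun p => fderiv ℝ φ p v) p w :=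
    fun v w => ((hpart v).continuous_fderiv one_ne_zero).clm_apply continuous_const
  have hφc := hC2.continuous
  have hpde : ∀ x ∈ Set.Icc (0 : ℝ) 1, ∀ y ∈ Set.Icc (0 : ℝ) 1,
      fderiv ℝ (fun p => fderiv ℝ φ p (1, 0)) (x, y) (1, 0) =
        -lam * φ (x, y) - fderiv ℝ (fun p => fderiv ℝ φ p (0, 1)) (x, y) (0, 1) := by
    intro x hx y hy
    rw [← heig (x, y) ⟨hx, hy⟩, laplacian2]
    simp only [fun x y => (hdir hd0 x y).1.deriv, fun x y => (hdir hd0 x y).2.deriv,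
      (hdir (hd1 _) x y).1.deriv, (hdir (hd1 _) x y).2.deriv, add_sub_cancel_right]
  have hs : Continuous fun y : ℝ => sin (n * (π * y)) := by fun_prop
  refine eq_zero_of_hasDerivAt_of_boundary (μ := (n * π) ^ 2 - lam) (sub_nonneg.2 hn)
    (hasDerivAt_integral_mul_of_contDiff (hC2.of_le one_le_two) hs 0 1)
    (hasDerivAt_integral_mul_of_contDiff (hpart (1, 0)) hs 0 1) (fun x hx => ?_) ?_ ?_ hc
  · have hyy : Continuous fun y => fderiv ℝ (fun p => fderiv ℝ φ p (0, 1)) (x, y) (0, 1) :=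
      (hcont _ _).comp (by fun_prop : Continuous fun y : ℝ => (x, y))
    have hibp := integral_deriv2_mul_sin (fun y => (hdir hd0 x y).2)
      (fun y => (hdir (hd1 (0, 1)) x y).2) hyy
      (hfr x hx 0 (by simp) (by simp)) (hfr x hx 1 (by simp) (by simp)) n
    calc _ = ∫ y in (0 : ℝ)..1, (-lam * (φ (x, y) * sin (n * (π * y))) -
          fderiv ℝ (fun p => fderiv ℝ φ p (0, 1)) (x, y) (0, 1) * sin (n * (π * y))) := by
          refine intervalIntegral.integral_congr fun y hy => ?_
          rw [Set.uIcc_of_le zero_le_one] at hy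
          simp only [hpde x hx y hy]
          ring
      _ = _ := by
          rw [intervalIntegral.integral_sub (Continuous.intervalIntegrable (by fun_prop) _ _)
            (Continuous.intervalIntegrable (by fun_prop) _ _), hibp,
            intervalIntegral.integral_const_mul]
          ring
  · refine intervalIntegral.integral_zero_ae (.of_forall fun y hy => ?_)
    rw [Set.uIoc_of_le zero_le_one] at hy
    rw [hfr 0 (by simp) y (Set.Ioc_subset_Icc_self hy) (by simp), zero_mul]
  · refine intervalIntegral.integral_zero_ae (.of_forall fun y hy => ?_)
    rw [Set.uIoc_of_le zero_le_one] at hy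
    rw [hfr 1 (by simp) y (Set.Ioc_subset_Icc_self hy) (by simp), zero_mul]

/-- the restriction of a Dirichlet eigenfunction on the unit square with
eigenvalue `λ` to a vertical line `{x = c}`, if not identically zero on `(0,1)`,
has at most `√λ/π` zeros in `(0,1)`. -/
theorem eigenfunction_vertical_zeros
    (φ : ℝ × ℝ → ℝ) (lam : ℝ) (hlam : 0 < lam)
    (hC2 : ContDiff ℝ 2 φ)
    (heig : ∀ p ∈ Set.Icc (0 : ℝ) 1 ×ˢ Set.Icc (0 : ℝ) 1, laplacian2 φ p = -lam * φ p)
    (hbd : ∀ p ∈ frontier (Set.Icc (0 : ℝ) 1 ×ˢ Set.Icc (0 : ℝ) 1), φ p = 0)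
    (c : ℝ) (hc : c ∈ Set.Ioo (0 : ℝ) 1)
    (hne : ∃ y ∈ Set.Ioo (0 : ℝ) 1, φ (c, y) ≠ 0) :
    ({y ∈ Set.Ioo (0 : ℝ) 1 | φ (c, y) = 0}).Finite ∧
    (({y ∈ Set.Ioo (0 : ℝ) 1 | φ (c, y) = 0}).ncard : ℝ) ≤ Real.sqrt lam / π := by
  have hnonneg : 0 ≤ √lam / π := div_nonneg (sqrt_nonneg _) pi_pos.le
  have hφc := hC2.continuous
  have hzero : ∀ n : ℕ, ⌊√lam / π⌋₊ < n →
      ∫ y in (0 : ℝ)..1, φ (c, y) * sin (n * (π * y)) = 0 := by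
    intro n hn
    refine integral_eigenfunction_mul_sin_eq_zero hC2 heig hbd ?_ (Set.Ioo_subset_Icc_self hc)
    have hlt : √lam < n * π := (div_lt_iff₀ pi_pos).1 (Nat.lt_of_floor_lt hn)
    rw [← sq_sqrt hlam.le]
    gcongr
  obtain ⟨hfin, hcard⟩ := ncard_zeros_le_of_eq_sum_sin (g := fun y => φ (c, y)) _
    (fun y hy => eq_sum_sin_of_integral_mul_sin_eq_zero (by fun_prop) hzero hy) hne
  exact ⟨hfin, (Nat.cast_le.2 hcard).trans (Nat.floor_le hnonneg)⟩
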